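/- arXiv:2210.02605 — 5 statements merged into one kernel-verified Lean document; each statement's English description precedes it below -/
import Mathlib

section
/- Let n ≥ 1, m ≥ 1, θ = (1,0,…,0) ∈ ℝⁿ, and let p : ℂⁿ → ℂ be a polynomial function that is homogeneous of degree m with real coefficients and satisfies p(θ) ≠ 0. Then the following are equivalent: (i) p(ξ - i·θ) ≠ 0 for every ξ ∈ ℝⁿ; (ii) for every ξ' ∈ ℝ^{n-1}, every complex root τ of the one-variable polynomial τ ↦ p(τ, ξ') is real. -/
/-- Euler scaling for the evaluation of a homogeneous polynomial. -/
theorem MvPolynomial.IsHomogeneous.eval_const_mul {σ R : Type*} [CommSemiring R]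
    {Q : MvPolynomial σ R} {m : ℕ} (hQ : Q.IsHomogeneous m) (c : R) (x : σ → R) :
    MvPolynomial.eval (fun j => c * x j) Q = c ^ m * MvPolynomial.eval x Q := by
  simp only [MvPolynomial.eval_eq, Finset.mul_sum]
  refine Finset.sum_congr rfl fun d hd => ?_
  have hdeg : ∑ j ∈ d.support, d j = m := by
    rw [← hQ (MvPolynomial.mem_support_iff.mp hd), Finsupp.weight_apply, Finsupp.sum]
    simp
  simp only [mul_pow, Finset.prod_mul_distrib, Finset.prod_pow_eq_pow_sum, hdeg]
  ring

/-- For a homogeneous polynomial `p` of degree `m ≥ 1` with real coefficients and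
`p(θ) ≠ 0`, `θ = (1,0,…,0)`, the hyperbolicity condition `p(ξ - iθ) ≠ 0` for all real `ξ`
is equivalent to the reality of all characteristic roots `τ` of `p(τ, ξ')`. -/
theorem homogeneous_hyperbolic_iff_real_roots (n m : ℕ) (hn : 1 ≤ n) (hm : 1 ≤ m)
    (P : MvPolynomial (Fin n) ℝ) (hhom : P.IsHomogeneous m)
    (θ : Fin n → ℝ) (hθ : θ = fun j : Fin n => if (j : ℕ) = 0 then (1 : ℝ) else 0)
    (hnonchar :
      MvPolynomial.eval (fun j => ((θ j : ℝ) : ℂ)) (P.map (algebraMap ℝ ℂ)) ≠ 0) :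
    (∀ ξ : Fin n → ℝ,
        MvPolynomial.eval (fun j => (ξ j : ℂ) - Complex.I * (θ j : ℂ))
          (P.map (algebraMap ℝ ℂ)) ≠ 0) ↔
      (∀ ξ' : Fin (n - 1) → ℝ, ∀ τ : ℂ,
        MvPolynomial.eval
          (fun j : Fin n =>
            if h : (j : ℕ) = 0 then τ else ((ξ' ⟨(j : ℕ) - 1, by omega⟩ : ℝ) : ℂ))
          (P.map (algebraMap ℝ ℂ)) = 0 → τ.im = 0) := by
  subst hθ
  constructor
  · intro h ξ' τ hτ
    by_contra hb
    have hQ := hhom.map (algebraMap ℝ ℂ)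
    have hb' : (τ.im : ℂ) ≠ 0 := Complex.ofReal_ne_zero.mpr hb
    refine h (fun j => if h : (j : ℕ) = 0 then -τ.re / τ.im
      else -ξ' ⟨(j : ℕ) - 1, by omega⟩ / τ.im) ?_
    have hscaled := (hQ.eval_const_mul (-(τ.im : ℂ)⁻¹) _).trans
      ((congrArg (_ * ·) hτ).trans (mul_zero _))
    convert hscaled using 3
    funext j
    beta_reduce
    split_ifs with hj
    · have hre := Complex.re_add_im τ
      push_cast
      field_simp
      linear_combination -hre
    · push_cast
      field_simp
      ring
  · intro h ξ hξ
    have him := h (fun k => ξ ⟨(k : ℕ) + 1, by omega⟩) (ξ ⟨0, hn⟩ - Complex.I) ?_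
    · simp at him
    · convert hξ using 3
      funext j
      beta_reduce
      split_ifs with hj
      · have hj0 : j = ⟨0, hn⟩ := Fin.ext hj
        simp [hj0]
      · have hj1 : (j : ℕ) - 1 + 1 = j := by omega
        simp [hj1]
end

section
/- Let m ≥ 1 and 0 ≤ r ≤ m be natural numbers, n ≥ 1, and c ∈ ℂ. Then there exists M > 0 such that for all ξ = (ξ₁,…,ξₙ) ∈ ℝⁿ and all τ ∈ ℝ with |τ| ≥ M·(1 + |ξ|)^{r/m}, one has (ξ₁ + i·τ)^m + c·ξₙ^r ≠ 0, where |ξ| denotes the Euclidean norm of ξ. -/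
open scoped Real

/-- The constant-coefficient operator `P(D) = D₁^m + c Dₙ^r` is `m/r`-hyperbolic:
`P(ξ + iτθ) ≠ 0` for `|τ| ≥ M (1 + |ξ|)^{r/m}`, `θ = (1,0,…,0)`. -/
theorem mr_hyperbolicity_model (m r n : ℕ) (hm : 1 ≤ m) (hr : r ≤ m) (hn : 1 ≤ n) (c : ℂ) :
    ∃ M > (0 : ℝ), ∀ ξ : EuclideanSpace ℝ (Fin n), ∀ τ : ℝ,
      M * (1 + ‖ξ‖) ^ ((r : ℝ) / (m : ℝ)) ≤ |τ| →
      ((ξ ⟨0, hn⟩ : ℂ) + Complex.I * (τ : ℂ)) ^ m +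
        c * ((ξ ⟨n - 1, by omega⟩ : ℝ) : ℂ) ^ r ≠ 0 := by
  refine ⟨1 + ‖c‖, by positivity, fun ξ τ h h0 => ?_⟩
  have hpos : (0 : ℝ) < 1 + ‖ξ‖ := by positivity
  have hlow : (1 + ‖c‖) ^ m * (1 + ‖ξ‖) ^ r ≤ |τ| ^ m := by
    have hpow := pow_le_pow_left₀ (by positivity) h m
    rwa [mul_pow, ← Real.rpow_mul_natCast hpos.le,
      div_mul_cancel₀ _ (by positivity : (m : ℝ) ≠ 0), Real.rpow_natCast] at hpow
  have him : |τ| ≤ ‖(ξ ⟨0, hn⟩ : ℂ) + Complex.I * (τ : ℂ)‖ := by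
    simpa using Complex.abs_im_le_norm ((ξ ⟨0, hn⟩ : ℂ) + Complex.I * (τ : ℂ))
  have hcoord : ‖ξ ⟨n - 1, by omega⟩‖ ≤ 1 + ‖ξ‖ :=
    (PiLp.norm_apply_le ξ _).trans (by linarith)
  have hup : |τ| ^ m ≤ ‖c‖ * (1 + ‖ξ‖) ^ r := calc
    |τ| ^ m ≤ ‖(ξ ⟨0, hn⟩ : ℂ) + Complex.I * (τ : ℂ)‖ ^ m := by gcongr
    _ = ‖c‖ * ‖ξ ⟨n - 1, by omega⟩‖ ^ r := by
      rw [← norm_pow, eq_neg_of_add_eq_zero_left h0, norm_neg, norm_mul, norm_pow,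
        Complex.norm_real]
    _ ≤ ‖c‖ * (1 + ‖ξ‖) ^ r := by gcongr
  have hM : 1 + ‖c‖ ≤ (1 + ‖c‖) ^ m :=
    le_self_pow₀ (by linarith [norm_nonneg c]) (by omega)
  have hlt : ‖c‖ * (1 + ‖ξ‖) ^ r < (1 + ‖c‖) ^ m * (1 + ‖ξ‖) ^ r :=
    mul_lt_mul_of_pos_right (by linarith) (by positivity)
  linarith
end

section
/- Let n ≥ 3, m ≥ 3, and b ∈ ℝ. In the polynomial ring ℝ[x₁,…,xₙ,ξ₁,…,ξₙ] in 2n variables, let p = ξ₁^{m-3}·(ξ₁^3 - (ξ₂^2 + x₂^2·ξₙ^2)·ξ₁ - b·x₂^3·ξₙ^3). Then Σ_{j=1}^{n} ∂²p/(∂x_j ∂ξ_j) = 0, where ∂/∂x_j and ∂/∂ξ_j denote formal partial derivatives of polynomials. -/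
open MvPolynomial

theorem MvPolynomial.pderiv_ofNat {R σ : Type*} [CommSemiring R] (i : σ) (k : ℕ)
    [k.AtLeastTwo] : pderiv i (ofNat(k) : MvPolynomial σ R) = 0 :=
  (pderiv i).map_natCast k

/-- For the symbol `p = ξ₁^{m-3}(ξ₁³ - (ξ₂² + x₂² ξₙ²)ξ₁ - b x₂³ ξₙ³)` of Proposition 2.1,
viewed in `ℝ[x₁,…,xₙ,ξ₁,…,ξₙ]` (the `x`-variables indexed by `Sum.inl`, the `ξ`-variables by
`Sum.inr`), one has `Σ_j ∂²p/(∂x_j ∂ξ_j) = 0`; hence all quantizations of `p` coincide. -/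
theorem sum_mixed_pderiv_eq_zero_Pb (n m : ℕ) (hn : 3 ≤ n) (hm : 3 ≤ m) (b : ℝ)
    (p : MvPolynomial (Fin n ⊕ Fin n) ℝ)
    (hp : p = X (Sum.inr ⟨0, by omega⟩) ^ (m - 3) *
        (X (Sum.inr ⟨0, by omega⟩) ^ 3 -
          (X (Sum.inr ⟨1, by omega⟩) ^ 2 +
            X (Sum.inl ⟨1, by omega⟩) ^ 2 * X (Sum.inr ⟨n - 1, by omega⟩) ^ 2) *
            X (Sum.inr ⟨0, by omega⟩) -
          C b * X (Sum.inl ⟨1, by omega⟩) ^ 3 * X (Sum.inr ⟨n - 1, by omega⟩) ^ 3)) :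
    ∑ j : Fin n, pderiv (Sum.inl j) (pderiv (Sum.inr j) p) = 0 := by
  subst hp
  refine Finset.sum_eq_zero fun j _ => ?_
  have h_zero_ne : (⟨0, by omega⟩ : Fin n) ≠ ⟨1, by omega⟩ := by simp
  have h_last_ne : (⟨n - 1, by omega⟩ : Fin n) ≠ ⟨1, by omega⟩ := by
    simp only [ne_eq, Fin.mk.injEq]; omega
  generalize (⟨0, by omega⟩ : Fin n) = first at *
  generalize (⟨n - 1, by omega⟩ : Fin n) = last at *
  generalize (⟨1, by omega⟩ : Fin n) = second at *
  by_cases hj : j = second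
  · subst hj
    simp [pderiv_X, pderiv_ofNat, h_zero_ne, h_last_ne]
  · have hx : second ≠ j := Ne.symm hj
    by_cases h_first : first = j <;> by_cases h_last : last = j <;>
      simp [pderiv_X, pderiv_ofNat, hx, h_first, h_last]
end

section
/- Let n ≥ 3, m ≥ 3, b ∈ ℝ, and let B ⊆ ℝⁿ be an open ball centered at the origin. Define the differential operator L by (Lu)(x) = ∂₁³u(x) - ∂₂²∂₁u(x) - x₂²·∂ₙ²∂₁u(x) - b·x₂³·∂ₙ³u(x). Suppose u : ℝⁿ → ℂ is smooth, ∂₁^{m-3}(Lu) vanishes on B, and for every j with 0 ≤ j ≤ m-4 and every point x ∈ B with x₁ = 0 one has ∂₁^{j+3}u(x) = ∂₂²∂₁^{j+1}u(x) + x₂²·∂ₙ²∂₁^{j+1}u(x) + b·x₂³·∂ₙ³∂₁^{j}u(x). Then Lu vanishes on B. -/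
/-- The partial derivative `∂_j` acting on functions on `ℝⁿ` (Euclidean space). -/
noncomputable def Pd {n : ℕ} (j : Fin n) (f : EuclideanSpace ℝ (Fin n) → ℂ) :
    EuclideanSpace ℝ (Fin n) → ℂ :=
  fun x => fderiv ℝ f x (EuclideanSpace.single j 1)

/-- The operator `L`, i.e. `op⁰(P_b)` up to a factor `i`:
`(Lu)(x) = ∂₁³u - ∂₂²∂₁u - x₂² ∂ₙ²∂₁u - b x₂³ ∂ₙ³u`. -/
noncomputable def Lop {n : ℕ} (hn : 3 ≤ n) (b : ℝ) (u : EuclideanSpace ℝ (Fin n) → ℂ) :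
    EuclideanSpace ℝ (Fin n) → ℂ :=
  fun x =>
    (Pd ⟨0, by omega⟩)^[3] u x -
      (Pd ⟨1, by omega⟩)^[2] (Pd ⟨0, by omega⟩ u) x -
      ((x ⟨1, by omega⟩ : ℝ) : ℂ) ^ 2 * (Pd ⟨n - 1, by omega⟩)^[2] (Pd ⟨0, by omega⟩ u) x -
      (b : ℂ) * ((x ⟨1, by omega⟩ : ℝ) : ℂ) ^ 3 * (Pd ⟨n - 1, by omega⟩)^[3] u x

namespace Pd

variable {n : ℕ} {f g : EuclideanSpace ℝ (Fin n) → ℂ}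

lemma contDiff (j : Fin n) (hf : ContDiff ℝ (⊤ : ℕ∞) f) : ContDiff ℝ (⊤ : ℕ∞) (Pd j f) :=
  (hf.fderiv_right (m := (⊤ : ℕ∞)) le_rfl).clm_apply contDiff_const

lemma contDiff_iterate (j : Fin n) (k : ℕ) (hf : ContDiff ℝ (⊤ : ℕ∞) f) :
    ContDiff ℝ (⊤ : ℕ∞) ((Pd j)^[k] f) := by
  induction k with
  | zero => exact hf
  | succ k ih => rw [Function.iterate_succ_apply']; exact contDiff j ih

lemma differentiable_of_contDiff (hf : ContDiff ℝ (⊤ : ℕ∞) f) : Differentiable ℝ f :=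
  hf.differentiable (by simp)

lemma comm (i j : Fin n) (hf : ContDiff ℝ (⊤ : ℕ∞) f) : Pd i (Pd j f) = Pd j (Pd i f) := by
  have hd : Differentiable ℝ (fderiv ℝ f) :=
    (hf.fderiv_right (m := (⊤ : ℕ∞)) le_rfl).differentiable (by simp)
  have key : ∀ (i j : Fin n) x, Pd i (Pd j f) x =
      fderiv ℝ (fderiv ℝ f) x (EuclideanSpace.single i 1) (EuclideanSpace.single j 1) := by
    intro i j x
    have h := (hd x).hasFDerivAt.clm_apply
      (hasFDerivAt_const (EuclideanSpace.single j (1 : ℝ)) x)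
    change fderiv ℝ (fun y => fderiv ℝ f y (EuclideanSpace.single j 1)) x _ = _
    rw [h.fderiv]
    simp
  funext x
  rw [key, key]
  exact second_derivative_symmetric (fun y => (differentiable_of_contDiff hf y).hasFDerivAt)
    (hd x).hasFDerivAt _ _

lemma comm_iterate (i j : Fin n) (k : ℕ) (hf : ContDiff ℝ (⊤ : ℕ∞) f) :
    Pd i ((Pd j)^[k] f) = (Pd j)^[k] (Pd i f) := by
  induction k with
  | zero => rfl
  | succ k ih =>
    rw [Function.iterate_succ_apply', Function.iterate_succ_apply',
      comm i j (contDiff_iterate j k hf), ih]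

lemma sub (j : Fin n) (hf : Differentiable ℝ f) (hg : Differentiable ℝ g) :
    Pd j (fun x => f x - g x) = fun x => Pd j f x - Pd j g x := by
  funext x
  simp only [Pd]
  rw [fderiv_fun_sub (hf x) (hg x)]
  rfl

lemma mul_of_constant_along (j : Fin n) (hg : Differentiable ℝ g) (hf : Differentiable ℝ f)
    (h : ∀ x (t : ℝ), g (x + t • EuclideanSpace.single j 1) = g x) :
    Pd j (fun x => g x * f x) = fun x => g x * Pd j f x := by
  funext x
  have h0 : fderiv ℝ g x (EuclideanSpace.single j 1) = 0 := by
    rw [← (hg x).lineDeriv_eq_fderiv]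
    simp [lineDeriv, h]
  simp only [Pd]
  rw [fderiv_fun_mul (hg x) (hf x)]
  simp [h0]

lemma eq_zero_of_vanishing_on_hyperplane (j : Fin n) (r : ℝ) (hf : Differentiable ℝ f)
    (hd : ∀ x ∈ Metric.ball (0 : EuclideanSpace ℝ (Fin n)) r, Pd j f x = 0)
    (h0 : ∀ x ∈ Metric.ball (0 : EuclideanSpace ℝ (Fin n)) r, x j = 0 → f x = 0) :
    ∀ x ∈ Metric.ball (0 : EuclideanSpace ℝ (Fin n)) r, f x = 0 := by
  intro x hx
  set y : EuclideanSpace ℝ (Fin n) := x - x j • EuclideanSpace.single j 1 with hy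
  have hyj : y j = 0 := by simp [hy]
  have hyx : ‖y‖ ≤ ‖x‖ := by
    rw [EuclideanSpace.norm_eq, EuclideanSpace.norm_eq]
    refine Real.sqrt_le_sqrt (Finset.sum_le_sum fun i _ => ?_)
    by_cases hi : i = j
    · subst hi
      rw [hyj]
      simp [sq_nonneg]
    · simp [hy, hi]
  have hyB : y ∈ Metric.ball (0 : EuclideanSpace ℝ (Fin n)) r := by
    rw [mem_ball_zero_iff] at hx ⊢
    exact hyx.trans_lt hx
  have hline : ∀ t : ℝ, HasDerivAt (fun t : ℝ => y + t • (x j • EuclideanSpace.single j (1 : ℝ)))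
      (x j • EuclideanSpace.single j (1 : ℝ)) t := by
    intro t
    simpa using ((hasDerivAt_id t).smul_const (x j • EuclideanSpace.single j (1 : ℝ))).const_add y
  have hcomp := fun t : ℝ => (hf _).hasFDerivAt.comp_hasDerivAt t (hline t)
  have hconst := constant_of_has_deriv_right_zero (a := 0) (b := 1)
    (f := f ∘ fun t : ℝ => y + t • (x j • EuclideanSpace.single j (1 : ℝ)))
    (fun t _ => (hcomp t).continuousAt.continuousWithinAt)
    (fun t ht => by
      have hmem : y + t • (x j • EuclideanSpace.single j (1 : ℝ)) ∈
          Metric.ball (0 : EuclideanSpace ℝ (Fin n)) r := by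
        have := (convex_ball (0 : EuclideanSpace ℝ (Fin n)) r).add_smul_sub_mem hyB hx
          ⟨ht.1, ht.2.le⟩
        simpa [hy] using this
      have h := (hcomp t).hasDerivWithinAt (s := Set.Ici t)
      have hz := hd _ hmem
      simp only [Pd] at hz
      rwa [map_smul, hz, smul_zero] at h)
    1 (by simp)
  have hxy : y + (1 : ℝ) • (x j • EuclideanSpace.single j (1 : ℝ)) = x := by simp [hy]
  simp only [Function.comp_apply, hxy, zero_smul, add_zero] at hconst
  rw [hconst, h0 y hyB hyj]

lemma eq_zero_of_iterate_eq_zero (j : Fin n) (r : ℝ) (k : ℕ) (hf : ContDiff ℝ (⊤ : ℕ∞) f)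
    (hd : ∀ x ∈ Metric.ball (0 : EuclideanSpace ℝ (Fin n)) r, (Pd j)^[k] f x = 0)
    (h0 : ∀ i < k, ∀ x ∈ Metric.ball (0 : EuclideanSpace ℝ (Fin n)) r, x j = 0 →
      (Pd j)^[i] f x = 0) :
    ∀ x ∈ Metric.ball (0 : EuclideanSpace ℝ (Fin n)) r, f x = 0 := by
  induction k with
  | zero => exact hd
  | succ k ih =>
    refine ih ?_ fun i hi => h0 i (hi.trans k.lt_succ_self)
    refine eq_zero_of_vanishing_on_hyperplane j r
      (differentiable_of_contDiff (contDiff_iterate j k hf)) (fun x hx => ?_)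
      (h0 k k.lt_succ_self)
    rw [← Function.iterate_succ_apply' (Pd j)]
    exact hd x hx

end Pd

namespace Lop

variable {n : ℕ} {u : EuclideanSpace ℝ (Fin n) → ℂ}

lemma contDiff_coord (i : Fin n) :
    ContDiff ℝ (⊤ : ℕ∞) (fun x : EuclideanSpace ℝ (Fin n) => ((x i : ℝ) : ℂ)) :=
  Complex.ofRealCLM.contDiff.comp (EuclideanSpace.proj (𝕜 := ℝ) i).contDiff

lemma contDiff (hn : 3 ≤ n) (b : ℝ) (hu : ContDiff ℝ (⊤ : ℕ∞) u) :
    ContDiff ℝ (⊤ : ℕ∞) (Lop hn b u) := by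
  have hc := contDiff_coord (⟨1, by omega⟩ : Fin n)
  exact (((Pd.contDiff_iterate _ 3 hu).sub
    (Pd.contDiff_iterate _ 2 (Pd.contDiff _ hu))).sub
    ((hc.pow 2).mul (Pd.contDiff_iterate _ 2 (Pd.contDiff _ hu)))).sub
    ((contDiff_const.mul (hc.pow 3)).mul (Pd.contDiff_iterate _ 3 hu))

lemma Pd_zero_comm (hn : 3 ≤ n) (b : ℝ) (hu : ContDiff ℝ (⊤ : ℕ∞) u) :
    Pd ⟨0, by omega⟩ (Lop hn b u) = Lop hn b (Pd ⟨0, by omega⟩ u) := by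
  have hc := contDiff_coord (⟨1, by omega⟩ : Fin n)
  have hu' := Pd.contDiff (⟨0, by omega⟩ : Fin n) hu
  have hA := Pd.contDiff_iterate (⟨0, by omega⟩ : Fin n) 3 hu
  have hB := Pd.contDiff_iterate (⟨1, by omega⟩ : Fin n) 2 hu'
  have hC := Pd.contDiff_iterate (⟨n - 1, by omega⟩ : Fin n) 2 hu'
  have hD := Pd.contDiff_iterate (⟨n - 1, by omega⟩ : Fin n) 3 hu
  have hc2 := hc.pow 2
  have hc3 := (contDiff_const (c := (b : ℂ))).mul (hc.pow 3)
  have hd {f : EuclideanSpace ℝ (Fin n) → ℂ} (hf : ContDiff ℝ (⊤ : ℕ∞) f) :=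
    Pd.differentiable_of_contDiff hf
  unfold Lop
  rw [Pd.sub _ (hd ((hA.sub hB).sub (hc2.mul hC))) (hd (hc3.mul hD)),
    Pd.sub _ (hd (hA.sub hB)) (hd (hc2.mul hC)), Pd.sub _ (hd hA) (hd hB),
    Pd.mul_of_constant_along _ (hd hc2) (hd hC) (by simp),
    Pd.mul_of_constant_along _ (hd hc3) (hd hD) (by simp),
    Pd.comm_iterate _ _ _ hu, Pd.comm_iterate _ _ _ hu', Pd.comm_iterate _ _ _ hu',
    Pd.comm_iterate _ _ _ hu]

lemma iterate_Pd_zero_comm (hn : 3 ≤ n) (b : ℝ) (k : ℕ) (hu : ContDiff ℝ (⊤ : ℕ∞) u) :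
    (Pd ⟨0, by omega⟩)^[k] (Lop hn b u) = Lop hn b ((Pd ⟨0, by omega⟩)^[k] u) := by
  induction k with
  | zero => rfl
  | succ k ih =>
    rw [Function.iterate_succ_apply', Function.iterate_succ_apply', ih,
      Pd_zero_comm hn b (Pd.contDiff_iterate _ k hu)]

end Lop

/-- Reduction in the proof of Proposition 2.1: if `∂₁^{m-3}(Lu) = 0` on a ball `B` centered
at the origin and the Cauchy data of `u` on `{x₁ = 0}` satisfy the compatibility recursion,
then `Lu = 0` on `B`. -/
theorem Lu_vanishes_of_reduction (n m : ℕ) (hn : 3 ≤ n) (hm : 3 ≤ m) (b : ℝ)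
    (r : ℝ) (hr : 0 < r)
    (u : EuclideanSpace ℝ (Fin n) → ℂ) (hu : ContDiff ℝ (⊤ : ℕ∞) u)
    (hL : ∀ x ∈ Metric.ball (0 : EuclideanSpace ℝ (Fin n)) r,
        (Pd ⟨0, by omega⟩)^[m - 3] (Lop hn b u) x = 0)
    (hdata : ∀ j : ℕ, j + 4 ≤ m →
        ∀ x ∈ Metric.ball (0 : EuclideanSpace ℝ (Fin n)) r, x ⟨0, by omega⟩ = 0 →
          (Pd ⟨0, by omega⟩)^[j + 3] u x =
            (Pd ⟨1, by omega⟩)^[2] ((Pd ⟨0, by omega⟩)^[j + 1] u) x +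
              ((x ⟨1, by omega⟩ : ℝ) : ℂ) ^ 2 *
                (Pd ⟨n - 1, by omega⟩)^[2] ((Pd ⟨0, by omega⟩)^[j + 1] u) x +
              (b : ℂ) * ((x ⟨1, by omega⟩ : ℝ) : ℂ) ^ 3 *
                (Pd ⟨n - 1, by omega⟩)^[3] ((Pd ⟨0, by omega⟩)^[j] u) x) :
    ∀ x ∈ Metric.ball (0 : EuclideanSpace ℝ (Fin n)) r, Lop hn b u x = 0 := by
  refine Pd.eq_zero_of_iterate_eq_zero _ r (m - 3) (Lop.contDiff hn b hu) hL ?_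
  intro j hj x hx hx0
  have h := hdata j (by omega) x hx hx0
  rw [Lop.iterate_Pd_zero_comm hn b j hu]
  unfold Lop
  rw [← Function.iterate_add_apply, ← Function.iterate_succ_apply' (Pd _) j,
    Nat.add_comm 3 j, h]
  ring
end

section
/- Let b be a real number with b² ≤ 4/27, let n ≥ 3 and m ≥ 3, and define p(x,ξ) = ξ₁^{m-3}·(ξ₁³ - (ξ₂² + x₂²ξₙ²)·ξ₁ - b·x₂³·ξₙ³) for x, ξ ∈ ℝⁿ. Then: (a) p(x, θ) = 1 for θ = (1,0,…,0) and every x ∈ ℝⁿ (so the hyperplanes x₁ = const. are non-characteristic), and (b) for every x ∈ ℝⁿ and ξ' ∈ ℝ^{n-1}, every complex root z of the polynomial z ↦ z^{m-3}·(z³ - (ξ₂² + x₂²ξₙ²)·z - b·x₂³·ξₙ³) is real. -/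
/-- A depressed real cubic `z³ - A z - B` with `A ≥ 0` and nonnegative discriminant has only
real roots. -/
theorem im_eq_zero_of_depressed_cubic_eq_zero {A B : ℝ} (hA : 0 ≤ A)
    (hD : 27 * B ^ 2 ≤ 4 * A ^ 3) {z : ℂ} (hz : z ^ 3 - (A : ℂ) * z - (B : ℂ) = 0) :
    z.im = 0 := by
  obtain ⟨u, v⟩ := z
  have hre := congrArg Complex.re hz
  have him := congrArg Complex.im hz
  simp [pow_succ] at hre him
  change v = 0
  by_contra hv
  have hv2 : 0 < v ^ 2 := by positivity
  have hA' : A = 3 * u ^ 2 - v ^ 2 := by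
    apply mul_right_cancel₀ hv
    linarith
  have hB : B = 2 * A * u - 8 * u ^ 3 := by
    have h : v ^ 2 = 3 * u ^ 2 - A := by linarith
    linear_combination (-1 : ℝ) * hre - 3 * u * h
  have hdisc : 27 * B ^ 2 - 4 * A ^ 3 = 4 * v ^ 2 * (12 * u ^ 2 - A) ^ 2 := by
    rw [hB, hA']
    ring
  have hpos : 0 < 12 * u ^ 2 - A := by linarith
  have : 0 < 4 * v ^ 2 * (12 * u ^ 2 - A) ^ 2 := by positivity
  linarith

/-- The discriminant of `z³ - (a² + s²) z - b s³` is nonnegative when `b² ≤ 4/27`. -/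
theorem twentySeven_mul_sq_le_four_mul_cube {b : ℝ} (hb : b ^ 2 ≤ 4 / 27) (a s : ℝ) :
    27 * (b * s ^ 3) ^ 2 ≤ 4 * (a ^ 2 + s ^ 2) ^ 3 := by
  calc 27 * (b * s ^ 3) ^ 2 = 27 * b ^ 2 * (s ^ 2) ^ 3 := by ring
    _ ≤ 4 * (a ^ 2 + s ^ 2) ^ 3 := by
      gcongr
      · linarith
      · exact le_add_of_nonneg_left (sq_nonneg a)

/-- For `b² ≤ 4/27`, the symbol `p(x,ξ) = ξ₁^{m-3}(ξ₁³ - (ξ₂² + x₂²ξₙ²)ξ₁ - b x₂³ξₙ³)` of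
Proposition 2.1 satisfies (a) the non-characteristic condition `p(x,θ) = 1`,
`θ = (1,0,…,0)`, and (b) all characteristic roots in `ξ₁` are real. -/
theorem Pb_noncharacteristic_and_hyperbolic (b : ℝ) (hb : b ^ 2 ≤ 4 / 27)
    (n m : ℕ) (hn : 3 ≤ n) (hm : 3 ≤ m)
    (p : (Fin n → ℝ) → (Fin n → ℝ) → ℝ)
    (hp : ∀ x ξ : Fin n → ℝ,
      p x ξ = (ξ ⟨0, by omega⟩) ^ (m - 3) *
        ((ξ ⟨0, by omega⟩) ^ 3 -
          ((ξ ⟨1, by omega⟩) ^ 2 + (x ⟨1, by omega⟩) ^ 2 * (ξ ⟨n - 1, by omega⟩) ^ 2) *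
            (ξ ⟨0, by omega⟩) -
          b * (x ⟨1, by omega⟩) ^ 3 * (ξ ⟨n - 1, by omega⟩) ^ 3))
    (θ : Fin n → ℝ) (hθ : θ = fun j : Fin n => if (j : ℕ) = 0 then (1 : ℝ) else 0) :
    (∀ x : Fin n → ℝ, p x θ = 1) ∧
      (∀ x : Fin n → ℝ, ∀ ξ' : Fin (n - 1) → ℝ, ∀ z : ℂ,
        z ^ (m - 3) *
            (z ^ 3 -
              (((ξ' ⟨0, by omega⟩ : ℝ) : ℂ) ^ 2 +
                ((x ⟨1, by omega⟩ : ℝ) : ℂ) ^ 2 * ((ξ' ⟨n - 2, by omega⟩ : ℝ) : ℂ) ^ 2) * z -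
              (b : ℂ) * ((x ⟨1, by omega⟩ : ℝ) : ℂ) ^ 3 *
                ((ξ' ⟨n - 2, by omega⟩ : ℝ) : ℂ) ^ 3) = 0 →
        z.im = 0) := by
  constructor
  · intro x
    have h : n - 1 ≠ 0 := by omega
    simp [hp, hθ, h]
  · intro x ξ' z hz
    rcases mul_eq_zero.mp hz with h | h
    · simp [eq_zero_of_pow_eq_zero h]
    · generalize ξ' ⟨0, by omega⟩ = a at h
      generalize x ⟨1, by omega⟩ = y at h
      generalize ξ' ⟨n - 2, by omega⟩ = t at h
      refine im_eq_zero_of_depressed_cubic_eq_zero (by positivity)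
        (twentySeven_mul_sq_le_four_mul_cube hb a (y * t)) ?_
      push_cast
      linear_combination h
end
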